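/- arXiv:2407.14547 — 2 statements merged into one kernel-verified Lean document; each statement's English description precedes it below -/
import Mathlib

section
/- The function G(x) = ((2x-1)(1-x)·K(x)² - 2x·K(x)·E(x) + E(x)²) / (4x²·K(x)²) is strictly increasing on (0,1), with limit -7/32 as x → 0⁺ and limit 0 as x → 1⁻. -/
open Real Set Filter

noncomputable def K (x : ℝ) : ℝ :=
  ∫ t in (0 : ℝ)..(π / 2), (1 - x * Real.sin t ^ 2) ^ (-(1/2) : ℝ)

noncomputable def E (x : ℝ) : ℝ :=
  ∫ t in (0 : ℝ)..(π / 2), (1 - x * Real.sin t ^ 2) ^ ((1/2) : ℝ)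

noncomputable def G (x : ℝ) : ℝ :=
  ((2 * x - 1) * (1 - x) * K x ^ 2 - 2 * x * K x * E x + E x ^ 2) / (4 * x ^ 2 * K x ^ 2)

noncomputable def JJ (p x : ℝ) : ℝ := ∫ t in (0 : ℝ)..(π / 2), (1 - x * Real.sin t ^ 2) ^ p

lemma K_eq : K = JJ (-(1/2)) := rfl
lemma E_eq : E = JJ (1/2) := rfl

lemma Delta_pos {x : ℝ} (hx : x < 1) (t : ℝ) : 0 < 1 - x * Real.sin t ^ 2 := by
  have h1 := Real.sin_sq_le_one t
  have h2 := sq_nonneg (Real.sin t)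
  rcases le_or_gt x 0 with h | h <;> nlinarith

lemma Delta_cont {x : ℝ} (hx : x < 1) (p : ℝ) :
    Continuous (fun t : ℝ => (1 - x * Real.sin t ^ 2) ^ p) := by
  refine Continuous.rpow_const (by fun_prop) (fun t => Or.inl (Delta_pos hx t).ne')

lemma Delta_int {x : ℝ} (hx : x < 1) (p a b : ℝ) :
    IntervalIntegrable (fun t : ℝ => (1 - x * Real.sin t ^ 2) ^ p) MeasureTheory.volume a b :=
  (Delta_cont hx p).intervalIntegrable a b

lemma JJ_hasDerivAt (p : ℝ) {x : ℝ} (hx : x < 1) :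
    HasDerivAt (JJ p)
      (∫ t in (0 : ℝ)..(π / 2), -Real.sin t ^ 2 * p * (1 - x * Real.sin t ^ 2) ^ (p - 1)) x := by
  set δ := (1 - x) / 2 with hδ
  have hδ0 : 0 < δ := by rw [hδ]; linarith
  have hlt : ∀ y ∈ Metric.closedBall x δ, y < 1 := by
    intro y hy
    rw [Metric.mem_closedBall, Real.dist_eq, abs_le] at hy
    linarith [hy.2]
  have hcont : ContinuousOn (fun z : ℝ × ℝ => -Real.sin z.2 ^ 2 * p *
      (1 - z.1 * Real.sin z.2 ^ 2) ^ (p - 1)) (Metric.closedBall x δ ×ˢ Set.Icc 0 (π / 2)) := by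
    refine ContinuousOn.mul (by fun_prop) ?_
    refine ContinuousOn.rpow_const (by fun_prop) ?_
    intro z hz
    exact Or.inl (Delta_pos (hlt z.1 hz.1) z.2).ne'
  obtain ⟨C, hC⟩ := ((isCompact_closedBall x δ).prod isCompact_Icc).exists_bound_of_continuousOn hcont
  have key := intervalIntegral.hasDerivAt_integral_of_dominated_loc_of_deriv_le
    (μ := MeasureTheory.volume) (a := 0) (b := π / 2) (x₀ := x) (s := Metric.ball x δ)
    (F := fun x t => (1 - x * Real.sin t ^ 2) ^ p)
    (F' := fun x t => -Real.sin t ^ 2 * p * (1 - x * Real.sin t ^ 2) ^ (p - 1))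
    (bound := fun _ => C)
    (Metric.ball_mem_nhds x hδ0) ?_ ?_ ?_ ?_ ?_ ?_
  · exact key.2
  · filter_upwards [Metric.ball_mem_nhds x hδ0] with y hy
    exact (Delta_cont (hlt y (Metric.ball_subset_closedBall hy)) p).aestronglyMeasurable
  · exact Delta_int hx p _ _
  · have := Delta_cont hx (p - 1)
    exact (Continuous.mul (by fun_prop) this).aestronglyMeasurable
  · refine Filter.Eventually.of_forall (fun t ht y hy => ?_)
    rw [Set.uIoc_of_le (by positivity)] at ht
    exact hC (y, t) ⟨Metric.ball_subset_closedBall hy, ht.1.le, ht.2⟩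
  · exact intervalIntegrable_const
  · refine Filter.Eventually.of_forall (fun t ht y hy => ?_)
    have h1 := Delta_pos (hlt y (Metric.ball_subset_closedBall hy)) t
    have h2 : HasDerivAt (fun y : ℝ => 1 - y * Real.sin t ^ 2) (-Real.sin t ^ 2) y := by
      simpa using ((hasDerivAt_id y).mul_const (Real.sin t ^ 2)).const_sub 1
    exact h2.rpow_const (Or.inl h1.ne')

lemma JJ_deriv_eq (p : ℝ) {x : ℝ} (hx : x < 1) (h0 : x ≠ 0) :
    HasDerivAt (JJ p) (p * (JJ p x - JJ (p - 1) x) / x) x := by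
  convert JJ_hasDerivAt p hx using 1
  rw [JJ, JJ, ← intervalIntegral.integral_sub (Delta_int hx _ _ _) (Delta_int hx _ _ _),
    div_eq_iff h0, mul_comm (∫ t in (0:ℝ)..(π / 2), _) x, ← intervalIntegral.integral_const_mul,
    ← intervalIntegral.integral_const_mul]
  refine intervalIntegral.integral_congr (fun t _ => ?_)
  have h1 := Delta_pos hx t
  have h2 : (1 - x * Real.sin t ^ 2) ^ p
      = (1 - x * Real.sin t ^ 2) ^ (p - 1) * (1 - x * Real.sin t ^ 2) := by
    rw [Real.rpow_sub_one h1.ne']; field_simp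
  simp only [h2]
  ring

lemma JJ_rel {x : ℝ} (hx : x < 1) (h0 : x ≠ 0) : (1 - x) * JJ (-(1/2) - 1) x = JJ (1/2) x := by
  have hd : ∀ t ∈ Set.uIcc 0 (π / 2), HasDerivAt
      (fun t => x * (Real.sin t * Real.cos t * (1 - x * Real.sin t ^ 2) ^ (-(1/2) : ℝ)))
      ((1 - x * Real.sin t ^ 2) ^ ((1/2) : ℝ)
        - (1 - x) * (1 - x * Real.sin t ^ 2) ^ (-(1/2) - 1 : ℝ)) t := by
    intro t _
    have h1 := Delta_pos hx t
    have h2 : HasDerivAt (fun t : ℝ => 1 - x * Real.sin t ^ 2)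
        (-(x * (2 * Real.sin t * Real.cos t))) t := by
      simpa using ((((Real.hasDerivAt_sin t).pow 2).const_mul x).const_sub 1)
    have h3 := h2.rpow_const (p := -(1/2)) (Or.inl h1.ne')
    have h4 := ((((Real.hasDerivAt_sin t).mul (Real.hasDerivAt_cos t)).mul h3).const_mul x)
    refine h4.congr_deriv ?_
    have e1 : (1 - x * Real.sin t ^ 2) ^ (-(1/2) : ℝ)
      = (1 - x * Real.sin t ^ 2) ^ (-(1/2) - 1 : ℝ) * (1 - x * Real.sin t ^ 2) := by
      rw [Real.rpow_sub_one h1.ne']; field_simp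
    have e2 : (1 - x * Real.sin t ^ 2) ^ (1/2 : ℝ)
      = (1 - x * Real.sin t ^ 2) ^ (-(1/2) - 1 : ℝ) * (1 - x * Real.sin t ^ 2) ^ 2 := by
      rw [← Real.rpow_natCast (1 - x * Real.sin t ^ 2) 2, ← Real.rpow_add h1]; norm_num
    have hc : Real.cos t ^ 2 = 1 - Real.sin t ^ 2 := Real.cos_sq' t
    simp only [e1, e2, Pi.mul_apply]
    generalize (1 - x * Real.sin t ^ 2) ^ (-(1/2) - 1 : ℝ) = D
    linear_combination (x * D * (1 - x * Real.sin t ^ 2) + x ^ 2 * D * Real.sin t ^ 2) * hc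
  have hi := intervalIntegral.integral_eq_sub_of_hasDerivAt hd
    ((Delta_int hx _ _ _).sub ((Delta_int hx _ _ _).const_mul _))
  rw [intervalIntegral.integral_sub (Delta_int hx _ _ _) ((Delta_int hx _ _ _).const_mul _),
    intervalIntegral.integral_const_mul] at hi
  simp at hi
  rw [JJ, JJ]
  norm_num at hi ⊢
  linarith

lemma E_deriv {x : ℝ} (hx : x < 1) (h0 : x ≠ 0) : HasDerivAt E ((E x - K x) / (2 * x)) x := by
  rw [E_eq, K_eq]
  convert JJ_deriv_eq (1/2) hx h0 using 1
  norm_num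
  field_simp

lemma K_deriv {x : ℝ} (hx : x < 1) (h0 : x ≠ 0) :
    HasDerivAt K ((E x - (1 - x) * K x) / (2 * x * (1 - x))) x := by
  have h := JJ_rel hx h0
  have h1 : (1 - x) ≠ 0 := by linarith
  rw [E_eq, K_eq]
  convert JJ_deriv_eq (-(1/2)) hx h0 using 1
  rw [← h]
  field_simp
  ring

lemma E_cont {x : ℝ} (hx : x < 1) : ContinuousAt E x := (JJ_hasDerivAt (1/2) hx).continuousAt
lemma K_cont {x : ℝ} (hx : x < 1) : ContinuousAt K x := (JJ_hasDerivAt (-(1/2)) hx).continuousAt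

lemma K_zero : K 0 = π / 2 := by simp [K]
lemma E_zero : E 0 = π / 2 := by simp [E]

lemma K_pos {x : ℝ} (hx : x < 1) : 0 < K x :=
  intervalIntegral.intervalIntegral_pos_of_pos (Delta_int hx _ _ _)
    (fun t => Real.rpow_pos_of_pos (Delta_pos hx t) _) (by positivity)

lemma E_pos {x : ℝ} (hx : x < 1) : 0 < E x :=
  intervalIntegral.intervalIntegral_pos_of_pos (Delta_int hx _ _ _)
    (fun t => Real.rpow_pos_of_pos (Delta_pos hx t) _) (by positivity)

lemma half_eq {x : ℝ} (hx : x < 1) (t : ℝ) : (1 - x * Real.sin t ^ 2) ^ ((1/2) : ℝ) =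
    (1 - x * Real.sin t ^ 2) ^ (-(1/2) : ℝ) * (1 - x * Real.sin t ^ 2) := by
  rw [← Real.rpow_add_one (Delta_pos hx t).ne']; norm_num

lemma E_le_K {x : ℝ} (hx : x < 1) (h0 : 0 ≤ x) : E x ≤ K x := by
  refine intervalIntegral.integral_mono_on (by positivity) (Delta_int hx _ _ _)
    (Delta_int hx _ _ _) (fun t _ => ?_)
  rw [half_eq hx]
  have := Real.rpow_pos_of_pos (Delta_pos hx t) (-(1/2))
  have h2 : 0 ≤ x * Real.sin t ^ 2 := by positivity
  nlinarith

lemma E_le {x : ℝ} (hx : x < 1) (h0 : 0 ≤ x) : E x ≤ π / 2 := by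
  have : E x ≤ ∫ t in (0:ℝ)..(π/2), (1:ℝ) := by
    refine intervalIntegral.integral_mono_on (by positivity) (Delta_int hx _ _ _)
      (by simp) (fun t _ => ?_)
    have h2 : 0 ≤ x * Real.sin t ^ 2 := by positivity
    exact Real.rpow_le_one (Delta_pos hx t).le (by linarith) (by norm_num)
  simpa using this

lemma K_le_E {x : ℝ} (hx : x < 1) (h0 : 0 ≤ x) : (1 - x) * K x ≤ E x := by
  rw [K, ← intervalIntegral.integral_const_mul]
  refine intervalIntegral.integral_mono_on (by positivity) ((Delta_int hx _ _ _).const_mul _)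
    (Delta_int hx _ _ _) (fun t _ => ?_)
  rw [half_eq hx, mul_comm]
  have := Real.rpow_pos_of_pos (Delta_pos hx t) (-(1/2))
  have h1 := Real.sin_sq_le_one t
  gcongr
  nlinarith

lemma P_pos {x s : ℝ} (h0 : 0 < x) (h1 : x < 1) (hs : x / 8 ≤ s) (hs1 : s ≤ 1) :
    0 < x * (1 - s) ^ 2 * (3 * x + s * x - 2) + 4 * (1 - x) * s * (4 - 3 * x - s * x) := by
  have hsp : 0 < s := by linarith
  have hsx : s * x < 1 := by nlinarith
  rcases le_or_gt 2 (3 * x + s * x) with h | h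
  · have a1 : 0 ≤ x * (1 - s) ^ 2 * (3 * x + s * x - 2) :=
      mul_nonneg (by positivity) (by linarith)
    have a2 : 0 < 4 * (1 - x) * s * (4 - 3 * x - s * x) :=
      mul_pos (mul_pos (by linarith) hsp) (by linarith)
    linarith
  · have b1 : (1 - s) ^ 2 * (2 - 3 * x - s * x)
        ≤ (1 - x / 8) ^ 2 * (2 - 3 * x - x / 8 * x) := by
      have c1 : (1 - s) ^ 2 ≤ (1 - x / 8) ^ 2 := by
        apply pow_le_pow_left₀ <;> linarith
      have c2 : 2 - 3 * x - s * x ≤ 2 - 3 * x - x / 8 * x := by nlinarith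
      exact mul_le_mul c1 c2 (by linarith) (by positivity)
    have b2 : x / 8 * (4 - 3 * x - x / 8 * x) ≤ s * (4 - 3 * x - s * x) := by
      have : 0 ≤ (s - x / 8) * (4 - 3 * x - s * x - x / 8 * x) :=
        mul_nonneg (by linarith) (by nlinarith)
      nlinarith
    have b3 : 0 < x ^ 3 * (25 / 32 + 5 / 64 * x + x ^ 2 / 512) := by positivity
    have b4 := mul_le_mul_of_nonneg_left b1 h0.le
    have b5 := mul_le_mul_of_nonneg_left b2 (show 0 ≤ 4 * (1 - x) by linarith)
    nlinarith

noncomputable def HH (x : ℝ) : ℝ := (8 - x) * E x - (8 - 5 * x - 3 * x ^ 2) * K x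
noncomputable def FF (x : ℝ) : ℝ := (1 - x / 2 - x ^ 2 / 16) * K x - E x

lemma HH_deriv {x : ℝ} (h0 : 0 < x) (h1 : x < 1) :
    HasDerivAt HH (-3 * E x + (3 + 9 / 2 * x) * K x) x := by
  have a1 : HasDerivAt (fun x : ℝ => 8 - x) (-1) x := (hasDerivAt_id x).const_sub 8
  have a2 : HasDerivAt (fun x : ℝ => 8 - 5 * x - 3 * x ^ 2) (-5 - 6 * x) x := by
    have := (((hasDerivAt_id x).const_mul 5).const_sub 8).sub (((hasDerivAt_id x).pow 2).const_mul 3)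
    refine this.congr_deriv ?_
    simp; ring
  refine ((a1.mul (E_deriv h1 h0.ne')).sub (a2.mul (K_deriv h1 h0.ne'))).congr_deriv ?_
  have : 1 - x ≠ 0 := by linarith
  field_simp
  ring

lemma FF_deriv {x : ℝ} (h0 : 0 < x) (h1 : x < 1) :
    HasDerivAt FF (HH x / (32 * (1 - x))) x := by
  have a2 : HasDerivAt (fun x : ℝ => 1 - x / 2 - x ^ 2 / 16) (-1 / 2 - x / 8) x := by
    have := (((hasDerivAt_id x).div_const 2).const_sub 1).sub (((hasDerivAt_id x).pow 2).div_const 16)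
    refine this.congr_deriv ?_
    simp; ring
  refine ((a2.mul (K_deriv h1 h0.ne')).sub (E_deriv h1 h0.ne')).congr_deriv ?_
  have : 1 - x ≠ 0 := by linarith
  unfold HH
  field_simp
  ring

lemma HH_cont {x : ℝ} (h1 : x < 1) : ContinuousAt HH x := by
  have := E_cont h1
  have := K_cont h1
  unfold HH
  fun_prop

lemma FF_cont {x : ℝ} (h1 : x < 1) : ContinuousAt FF x := by
  have := E_cont h1
  have := K_cont h1
  unfold FF
  fun_prop

lemma HH_zero : HH 0 = 0 := by simp [HH, K_zero, E_zero]
lemma FF_zero : FF 0 = 0 := by simp [FF, K_zero, E_zero]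

lemma HH_nonneg {x : ℝ} (h0 : 0 ≤ x) (h1 : x < 1) : 0 ≤ HH x := by
  have hm : MonotoneOn HH (Ico 0 1) := by
    refine monotoneOn_of_hasDerivWithinAt_nonneg (convex_Ico 0 1)
      (fun y hy => (HH_cont hy.2).continuousWithinAt)
      (fun y hy => ?_) (f' := fun x => -3 * E x + (3 + 9 / 2 * x) * K x) (fun y hy => ?_)
    · rw [interior_Ico] at hy
      exact (HH_deriv hy.1 hy.2).hasDerivWithinAt
    · rw [interior_Ico] at hy
      have := E_le_K hy.2 hy.1.le
      have h2 := mul_pos hy.1 (K_pos hy.2)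
      nlinarith
  rw [← HH_zero]
  exact hm ⟨le_rfl, by norm_num⟩ ⟨h0, h1⟩ h0

lemma FF_nonneg {x : ℝ} (h0 : 0 ≤ x) (h1 : x < 1) : 0 ≤ FF x := by
  have hm : MonotoneOn FF (Ico 0 1) := by
    refine monotoneOn_of_hasDerivWithinAt_nonneg (convex_Ico 0 1)
      (fun y hy => (FF_cont hy.2).continuousWithinAt)
      (fun y hy => ?_) (f' := fun x => HH x / (32 * (1 - x))) (fun y hy => ?_)
    · rw [interior_Ico] at hy
      exact (FF_deriv hy.1 hy.2).hasDerivWithinAt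
    · rw [interior_Ico] at hy
      have := HH_nonneg hy.1.le hy.2
      exact div_nonneg this (by linarith [hy.2])
  rw [← FF_zero]
  exact hm ⟨le_rfl, by norm_num⟩ ⟨h0, h1⟩ h0

noncomputable def gg (x : ℝ) : ℝ :=
  ((2 * x - 1) * (1 - x) - 2 * x * (E x / K x) + (E x / K x) ^ 2) / (4 * x ^ 2)

lemma G_eq {x : ℝ} (h1 : x < 1) : G x = gg x := by
  have := (K_pos h1).ne'
  unfold G gg
  rcases eq_or_ne x 0 with h | h
  · simp [h]
  · field_simp

lemma u_deriv {x : ℝ} (h0 : 0 < x) (h1 : x < 1) :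
    HasDerivAt (fun x => E x / K x)
      ((-(1 - x) + 2 * (1 - x) * (E x / K x) - (E x / K x) ^ 2) / (2 * x * (1 - x))) x := by
  refine ((E_deriv h1 h0.ne').div (K_deriv h1 h0.ne') (K_pos h1).ne').congr_deriv ?_
  have := (K_pos h1).ne'
  have : 1 - x ≠ 0 := by linarith
  field_simp
  ring

lemma gg_deriv {x s : ℝ} (h0 : 0 < x) (h1 : x < 1) (hs : s = (2 - x - 2 * (E x / K x)) / x) :
    HasDerivAt gg ((x * (1 - s) ^ 2 * (3 * x + s * x - 2)
      + 4 * (1 - x) * s * (4 - 3 * x - s * x)) / (32 * x ^ 2 * (1 - x))) x := by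
  have hu := u_deriv h0 h1
  have a1 : HasDerivAt (fun x : ℝ => (2 * x - 1) * (1 - x)) (3 - 4 * x) x := by
    refine ((((hasDerivAt_id x).const_mul 2).sub_const 1).mul
      ((hasDerivAt_id x).const_sub 1)).congr_deriv ?_
    simp; ring
  have a2 : HasDerivAt (fun x : ℝ => 2 * x) 2 x := by
    simpa using (hasDerivAt_id x).const_mul 2
  have a3 : HasDerivAt (fun x : ℝ => 4 * x ^ 2) (8 * x) x := by
    refine (((hasDerivAt_id x).pow 2).const_mul 4).congr_deriv ?_
    simp; ring
  refine (((a1.sub (a2.mul hu)).add (hu.pow 2)).div a3 (by positivity)).congr_deriv ?_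
  have hux : E x / K x = (2 - x - s * x) / 2 := by
    rw [hs]; field_simp; ring
  have : 1 - x ≠ 0 := by linarith
  simp only [Pi.add_apply, Pi.sub_apply, Pi.mul_apply, Pi.pow_apply, hux]
  field_simp
  ring

lemma G_mono : StrictMonoOn G (Ioo 0 1) := by
  have hm : StrictMonoOn gg (Ioo 0 1) := by
    refine strictMonoOn_of_deriv_pos (convex_Ioo 0 1)
      (fun y hy => (gg_deriv hy.1 hy.2 rfl).continuousAt.continuousWithinAt) (fun x hx => ?_)
    rw [interior_Ioo] at hx
    rw [(gg_deriv hx.1 hx.2 rfl).deriv]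
    have hK := K_pos hx.2
    have hF := FF_nonneg hx.1.le hx.2
    have hE := K_le_E hx.2 hx.1.le
    have hx0 := hx.1
    unfold FF at hF
    refine div_pos (P_pos hx.1 hx.2 ?_ ?_) (mul_pos (by positivity) (by linarith [hx.2]))
    · rw [le_div_iff₀ hx.1]
      have : E x / K x ≤ 1 - x / 2 - x ^ 2 / 16 := by
        rw [div_le_iff₀ hK]; linarith
      linarith
    · rw [div_le_one hx.1]
      have : 1 - x ≤ E x / K x := by
        rw [le_div_iff₀ hK]; linarith
      linarith
  exact hm.congr (fun x hx => (G_eq hx.2).symm)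

lemma lim_zero : Tendsto G (nhdsWithin 0 (Ioo 0 1)) (nhds (-7/32)) := by
  rw [nhdsWithin_Ioo_eq_nhdsGT one_pos]
  have hK : Tendsto K (nhdsWithin 0 (Ioi 0)) (nhds (π / 2)) := by
    rw [← K_zero]; exact (K_cont one_pos).continuousWithinAt
  have hE : Tendsto E (nhdsWithin 0 (Ioi 0)) (nhds (π / 2)) := by
    rw [← E_zero]; exact (E_cont one_pos).continuousWithinAt
  have hx : Tendsto (fun x : ℝ => x) (nhdsWithin 0 (Ioi 0)) (nhds 0) :=
    tendsto_nhdsWithin_of_tendsto_nhds tendsto_id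
  have hH0 : Tendsto HH (nhdsWithin 0 (Ioi 0)) (nhds 0) := by
    have h : ContinuousWithinAt HH (Ioi 0) 0 := (HH_cont one_pos).continuousWithinAt
    rw [ContinuousWithinAt, HH_zero] at h
    exact h
  have hF0 : Tendsto FF (nhdsWithin 0 (Ioi 0)) (nhds 0) := by
    have h : ContinuousWithinAt FF (Ioi 0) 0 := (FF_cont one_pos).continuousWithinAt
    rw [ContinuousWithinAt, FF_zero] at h
    exact h
  have hH : Tendsto (fun x => HH x / x) (nhdsWithin 0 (Ioi 0)) (nhds 0) := by
    refine HasDerivAt.lhopital_zero_right_on_Ioo one_pos (fun x hx => HH_deriv hx.1 hx.2)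
      (fun x _ => hasDerivAt_id x) (by simp) hH0 hx ?_
    have := (hE.const_mul (-3)).add (((hx.const_mul (9/2)).const_add 3).mul hK)
    simpa using this
  have hF : Tendsto (fun x => FF x / x ^ 2) (nhdsWithin 0 (Ioi 0)) (nhds 0) := by
    refine HasDerivAt.lhopital_zero_right_on_Ioo one_pos (fun x hx => FF_deriv hx.1 hx.2)
      (g' := fun x => 2 * x)
      (fun x _ => by simpa using hasDerivAt_pow 2 x) (fun x hx => by linarith [hx.1]) hF0
      (by simpa using hx.pow 2) ?_
    have := hH.div ((hx.const_sub 1).const_mul 64) (by norm_num)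
    rw [zero_div] at this
    refine this.congr (fun x => ?_)
    simp only [Pi.div_apply]
    rw [div_div, div_div]; congr 1; ring
  have hq : Tendsto (fun x => 1 / 8 + 2 * (FF x / x ^ 2) / K x) (nhdsWithin 0 (Ioi 0))
      (nhds (1 / 8)) := by
    have := ((hF.const_mul 2).div hK (by positivity)).const_add (1/8)
    simpa using this
  -- write q for the quotient s / x
  have hfin : Tendsto (fun x => (-3 / 4 + 3 / 2 * (x * (1 / 8 + 2 * (FF x / x ^ 2) / K x))
      + (x * (1 / 8 + 2 * (FF x / x ^ 2) / K x)) ^ 2 / 4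
      - (1 / 8 + 2 * (FF x / x ^ 2) / K x)) / 4) (nhdsWithin 0 (Ioi 0)) (nhds (-7/32)) := by
    have h1 := hx.mul hq
    have := ((((h1.const_mul (3/2)).const_add (-3/4)).add ((h1.pow 2).div_const 4)).sub hq).div_const 4
    convert this using 2
    norm_num
  refine hfin.congr' ?_
  filter_upwards [Ioo_mem_nhdsGT (one_pos : (0:ℝ) < 1)] with x hx
  rw [G_eq hx.2]
  have := (K_pos hx.2).ne'
  have := hx.1.ne'
  unfold gg FF
  field_simp
  ring

lemma K_lower {x : ℝ} (h0 : 0 < x) (h1 : x < 1) :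
    Real.log ((π / 2 + √(1 - x)) / √(1 - x)) ≤ K x := by
  have he : 0 < √(1 - x) := Real.sqrt_pos.mpr (by linarith)
  set e := √(1 - x) with hedef
  have hsq : e ^ 2 = 1 - x := Real.sq_sqrt (by linarith)
  have hi : ∫ t in (0:ℝ)..(π / 2), (π / 2 + e - t)⁻¹ = Real.log ((π / 2 + e) / e) := by
    rw [intervalIntegral.integral_comp_sub_left (fun y => y⁻¹), integral_inv_of_pos] <;>
    · try simp
      try positivity
  rw [← hi]
  have hpi := Real.pi_pos
  refine intervalIntegral.integral_mono_on (by positivity) ?_ (Delta_int h1 _ _ _) (fun t ht => ?_)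
  · refine ContinuousOn.intervalIntegrable (ContinuousOn.inv₀ (by fun_prop) ?_)
    intro t ht
    rw [Set.uIcc_of_le (by positivity)] at ht
    linarith [ht.2]
  · have hD := Delta_pos h1 t
    rw [Real.rpow_neg hD.le, ← Real.sqrt_eq_rpow]
    apply inv_anti₀ (Real.sqrt_pos.mpr hD)
    rw [Real.sqrt_le_left (by linarith [ht.2])]
    have c0 : 0 ≤ Real.cos t := Real.cos_nonneg_of_mem_Icc ⟨by linarith [ht.1], ht.2⟩
    have c1 : Real.cos t ≤ π / 2 - t := by
      rw [← Real.sin_pi_div_two_sub]; exact Real.sin_le (by linarith [ht.2])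
    have c2 : Real.cos t ^ 2 = 1 - Real.sin t ^ 2 := Real.cos_sq' t
    have c3 := sq_nonneg (Real.cos t)
    have c4 : Real.cos t ^ 2 ≤ (π / 2 - t) ^ 2 := pow_le_pow_left₀ c0 c1 2
    have c5 : 0 ≤ (π / 2 - t) * e := mul_nonneg (by linarith) he.le
    nlinarith

lemma K_tendsto : Tendsto K (nhdsWithin 1 (Ioo 0 1)) atTop := by
  have h1 : Tendsto (fun x : ℝ => √(1 - x)) (nhdsWithin 1 (Ioo 0 1)) (nhdsWithin 0 (Ioi 0)) := by
    rw [tendsto_nhdsWithin_iff]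
    constructor
    · apply tendsto_nhdsWithin_of_tendsto_nhds
      have : ContinuousAt (fun x : ℝ => √(1 - x)) 1 := by fun_prop
      simpa [ContinuousAt] using this
    · filter_upwards [self_mem_nhdsWithin] with x hx
      exact Real.sqrt_pos.mpr (by linarith [hx.2])
  have h2 := tendsto_inv_nhdsGT_zero.comp h1
  have h3 : Tendsto (fun x : ℝ => π / 2 + √(1 - x)) (nhdsWithin 1 (Ioo 0 1)) (nhds (π / 2)) := by
    simpa using (tendsto_nhds_of_tendsto_nhdsWithin h1).const_add (π / 2)
  have h4 := Real.tendsto_log_atTop.comp (h3.pos_mul_atTop (by positivity) h2)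
  refine tendsto_atTop_mono' _ ?_ h4
  filter_upwards [self_mem_nhdsWithin] with x hx
  have := K_lower hx.1 hx.2
  rw [div_eq_mul_inv] at this
  exact this

lemma lim_one : Tendsto G (nhdsWithin 1 (Ioo 0 1)) (nhds 0) := by
  have hu : Tendsto (fun x => E x / K x) (nhdsWithin 1 (Ioo 0 1)) (nhds 0) := by
    refine squeeze_zero' (g := fun x => π / 2 / K x) ?_ ?_ (K_tendsto.const_div_atTop _)
    · filter_upwards [self_mem_nhdsWithin] with x hx
      exact (div_pos (E_pos hx.2) (K_pos hx.2)).le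
    · filter_upwards [self_mem_nhdsWithin] with x hx
      exact div_le_div_of_nonneg_right (E_le hx.2 hx.1.le) (K_pos hx.2).le
  have hx : Tendsto (fun x : ℝ => x) (nhdsWithin 1 (Ioo 0 1)) (nhds 1) :=
    tendsto_nhdsWithin_of_tendsto_nhds tendsto_id
  have : Tendsto gg (nhdsWithin 1 (Ioo 0 1)) (nhds 0) := by
    have h := ((((hx.const_mul 2).sub_const 1).mul (hx.const_sub 1)).sub
      ((hx.const_mul 2).mul hu)).add (hu.pow 2) |>.div ((hx.pow 2).const_mul 4) (by norm_num)
    have e : ((2 * 1 - 1) * (1 - 1) - 2 * 1 * 0 + 0 ^ 2) / (4 * 1 ^ 2) = (0 : ℝ) := by norm_num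
    rw [e] at h
    exact h
  refine this.congr' ?_
  filter_upwards [self_mem_nhdsWithin] with x hx
  exact (G_eq hx.2).symm

theorem stmt13 :
    StrictMonoOn G (Ioo 0 1) ∧
    Tendsto G (nhdsWithin 0 (Ioo 0 1)) (nhds (-7/32)) ∧
    Tendsto G (nhdsWithin 1 (Ioo 0 1)) (nhds 0) := by
  exact ⟨G_mono, lim_zero, lim_one⟩
end

section
/- The function h_p(x) = (1-x)^p · K(x) is strictly convex on (0,1) if p ≤ 0 or p ≥ 3(2+√2)/8, and strictly concave on (0,1) if p ∈ [3(2-√2)/8, 1]. -/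
open Real Set Filter

noncomputable def Wc (n : ℕ) : ℝ := Ring.multichoose (1/2 : ℝ) n

noncomputable def Ic (n : ℕ) : ℝ := ∫ t in (0 : ℝ)..(π / 2), Real.sin t ^ (2 * n)

noncomputable def cc (n : ℕ) : ℝ := Wc n * Ic n

lemma Wc_zero : Wc 0 = 1 := by simp [Wc]

lemma Wc_succ (n : ℕ) : Wc (n + 1) * (n + 1) = Wc n * (n + 1/2) := by
  have h1 := Ring.factorial_nsmul_multichoose_eq_ascPochhammer (1/2 : ℝ) n
  have h2 := Ring.factorial_nsmul_multichoose_eq_ascPochhammer (1/2 : ℝ) (n+1)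
  rw [Polynomial.ascPochhammer_smeval_eq_eval] at h1 h2
  rw [ascPochhammer_succ_eval, ← h1] at h2
  have hf : (n.factorial : ℝ) ≠ 0 := by positivity
  simp only [nsmul_eq_mul, Nat.factorial_succ] at h2
  push_cast at h2
  unfold Wc
  apply mul_left_cancel₀ hf
  linarith

lemma Wc_pos (n : ℕ) : 0 < Wc n := by
  induction n with
  | zero => simp [Wc_zero]
  | succ k ih =>
    have := Wc_succ k
    have h : 0 < Wc k * (k + 1/2) := by positivity
    rw [← this] at h
    exact pos_of_mul_pos_left h (by positivity)

lemma Ic_zero : Ic 0 = π / 2 := by simp [Ic]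

lemma Ic_succ (n : ℕ) : Ic (n + 1) * (n + 1) = Ic n * (n + 1/2) := by
  unfold Ic
  have := integral_sin_pow (a := 0) (b := π / 2) (2 * n)
  rw [show 2 * (n + 1) = 2 * n + 2 by ring, this]
  simp
  field_simp

lemma Ic_pos (n : ℕ) : 0 < Ic n := by
  induction n with
  | zero => rw [Ic_zero]; positivity
  | succ k ih =>
    have := Ic_succ k
    have h : 0 < Ic k * (k + 1/2) := by positivity
    rw [← this] at h
    exact pos_of_mul_pos_left h (by positivity)

lemma cc_pos (n : ℕ) : 0 < cc n := mul_pos (Wc_pos n) (Ic_pos n)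

lemma cc_succ (n : ℕ) : cc (n + 1) * (n + 1) ^ 2 = cc n * (n + 1/2) ^ 2 := by
  have h1 := Wc_succ n
  have h2 := Ic_succ n
  unfold cc
  calc _ = (Wc (n + 1) * (n + 1)) * (Ic (n + 1) * (n + 1)) := by ring
    _ = _ := by rw [h1, h2]; ring

lemma cc_le (n : ℕ) : cc n ≤ 2 := by
  induction n with
  | zero => rw [cc, Wc_zero, Ic_zero]; linarith [Real.pi_le_four]
  | succ k ih =>
    have h := cc_succ k
    have h0 := cc_pos k
    have : cc (k+1) * (k+1)^2 ≤ cc k * (k+1)^2 := by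
      rw [h]; gcongr; norm_num
    have := le_of_mul_le_mul_right this (by positivity)
    linarith

lemma hasSum_rpow (y : ℝ) (hy : |y| < 1) :
    HasSum (fun n => Wc n * y ^ n) ((1 - y) ^ (-(1/2) : ℝ)) := by
  have h := (Real.one_div_one_sub_rpow_hasFPowerSeriesOnBall_zero (1/2)).hasSum (y := y)
    (by simpa [← enorm_eq_nnnorm, ← ofReal_norm] using hy)
  have e : (1 - y) ^ (-(1/2) : ℝ) = 1 / (1 - (0 + y)) ^ (1/2 : ℝ) := by
    rw [zero_add, Real.rpow_neg (by linarith [(abs_lt.1 hy).2]), ← one_div]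
  rw [e]
  convert! h using 2 with n
  simp [Wc, Ring.multichoose_eq, mul_comm]

lemma K_hasSum (x : ℝ) (hx : |x| < 1) : HasSum (fun n => cc n * x ^ n) (K x) := by
  have key := intervalIntegral.hasSum_integral_of_dominated_convergence
    (μ := MeasureTheory.volume) (a := 0) (b := π / 2)
    (F := fun (n : ℕ) t => Wc n * (x * Real.sin t ^ 2) ^ n)
    (f := fun t => (1 - x * Real.sin t ^ 2) ^ (-(1/2) : ℝ))
    (fun n _ => Wc n * |x| ^ n) ?_ ?_ ?_ ?_ ?_
  · unfold K
    convert! key using 2 with n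
    unfold cc Ic
    simp_rw [mul_pow, ← pow_mul]
    rw [intervalIntegral.integral_const_mul, intervalIntegral.integral_const_mul]
    ring
  · intro n
    exact (by fun_prop : Continuous _).aestronglyMeasurable
  · intro n
    refine .of_forall fun t _ => ?_
    rw [norm_mul, norm_pow, norm_mul, Real.norm_of_nonneg (Wc_pos n).le]
    have := (Wc_pos n).le
    gcongr
    rw [Real.norm_eq_abs, Real.norm_of_nonneg (by positivity)]
    exact mul_le_of_le_one_right (abs_nonneg _) (Real.sin_sq_le_one t)
  · refine .of_forall fun t _ => ?_
    exact (hasSum_rpow |x| (by simpa)).summable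
  · exact intervalIntegrable_const
  · refine .of_forall fun t _ => hasSum_rpow _ ?_
    rw [abs_mul]
    refine lt_of_le_of_lt (mul_le_of_le_one_right (abs_nonneg _) ?_) hx
    rw [abs_of_nonneg (by positivity)]
    exact Real.sin_sq_le_one t

lemma bsum (k : ℕ) (r : ℝ) (h0 : 0 ≤ r) (hr : r < 1) :
    Summable (fun n : ℕ => ((n : ℝ) + 1) ^ k * r ^ n) := by
  rcases h0.eq_or_lt with rfl | h0
  · exact summable_of_ne_finset_zero (s := {0}) (by intro b hb; simp at hb; simp [hb])
  have := (summable_nat_add_iff 1).2 (summable_pow_mul_geometric_of_norm_lt_one (R := ℝ) k (r := r)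
    (by rwa [Real.norm_of_nonneg h0.le]))
  convert! this.mul_right r⁻¹ using 2 with n
  push_cast
  field_simp
  ring

lemma asum (a : ℕ → ℝ) (C : ℝ) (k : ℕ) (ha : ∀ n, |a n| ≤ C * ((n : ℝ) + 1) ^ k)
    (x : ℝ) (hx : |x| < 1) : Summable (fun n => a n * x ^ n) := by
  refine .of_norm_bounded ((bsum k |x| (abs_nonneg _) hx).mul_left C) fun n => ?_
  rw [norm_mul, norm_pow, Real.norm_eq_abs, Real.norm_eq_abs, ← mul_assoc]
  gcongr
  exact ha n

lemma dbound (a : ℕ → ℝ) (C : ℝ) (k : ℕ) (ha : ∀ n, |a n| ≤ C * ((n : ℝ) + 1) ^ k) (n : ℕ) :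
    |((n : ℝ) + 1) * a (n + 1)| ≤ (C * 2 ^ k) * ((n : ℝ) + 1) ^ (k + 1) := by
  have hC : 0 ≤ C := by simpa using (abs_nonneg _).trans (ha 0)
  rw [abs_mul, abs_of_nonneg (by positivity : (0:ℝ) ≤ n + 1)]
  have h := ha (n + 1)
  push_cast at h
  have h2 : ((n : ℝ) + 1 + 1) ^ k ≤ (2 * (n + 1)) ^ k := by
    gcongr; linarith [(Nat.cast_nonneg n : (0:ℝ) ≤ n)]
  calc _ ≤ ((n : ℝ) + 1) * (C * (2 * (n + 1)) ^ k) := by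
        gcongr; exact h.trans (by gcongr)
    _ = _ := by rw [mul_pow]; ring

lemma shift (a : ℕ → ℝ) (x S : ℝ) (h : HasSum (fun n : ℕ => ((n : ℝ) + 1) * a (n + 1) * x ^ n) S) :
    HasSum (fun n : ℕ => (n : ℝ) * a n * x ^ n) (x * S) := by
  rw [← hasSum_nat_add_iff' 1]
  simp
  convert! h.mul_left x using 2 with n
  ring

lemma dser (a : ℕ → ℝ) (C : ℝ) (k : ℕ) (ha : ∀ n, |a n| ≤ C * ((n : ℝ) + 1) ^ k)
    (x : ℝ) (hx : |x| < 1) :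
    HasDerivAt (fun y => ∑' n, a n * y ^ n) (∑' n : ℕ, ((n : ℝ) + 1) * a (n + 1) * x ^ n) x := by
  obtain ⟨r, hr1, hr2⟩ := exists_between hx
  have hr0 : 0 ≤ r := (abs_nonneg _).trans hr1.le
  have hC : 0 ≤ C := by simpa using (abs_nonneg _).trans (ha 0)
  have hsum : Summable (fun n : ℕ => (n : ℝ) * |a n| * r ^ (n - 1)) := by
    rw [← summable_nat_add_iff 1]
    convert! asum (fun n : ℕ => ((n : ℝ) + 1) * |a (n + 1)|) _ _
      (dbound (fun n => |a n|) C k (by simpa using ha)) r (by rwa [abs_of_nonneg hr0]) using 2 with n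
    simp
  have := hasDerivAt_tsum_of_isPreconnected (g := fun n y => a n * y ^ n)
    (g' := fun n y => a n * (n * y ^ (n - 1))) (t := Metric.ball (0 : ℝ) r) (y₀ := 0) (y := x)
    hsum Metric.isOpen_ball (convex_ball _ _).isPreconnected
    (fun n y _ => (hasDerivAt_pow n y).const_mul _) ?_ ?_ ?_ ?_
  · convert! this using 1
    have hs : Summable (fun n : ℕ => a n * (n * x ^ (n - 1))) := by
      refine .of_norm_bounded hsum fun n => ?_
      rw [norm_mul, norm_mul, norm_pow]
      simp only [Real.norm_eq_abs, Nat.abs_cast]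
      rw [← mul_assoc, mul_comm |a n|]
      gcongr
    rw [hs.tsum_eq_zero_add]
    simp
    congr 1; ext n; ring
  · intro n y hy
    have hy : |y| < r := by simpa using hy
    rw [norm_mul, norm_mul, norm_pow]
    simp only [Real.norm_eq_abs, Nat.abs_cast]
    rw [← mul_assoc, mul_comm |a n|]
    gcongr
  · simpa using lt_of_le_of_lt (abs_nonneg _) hr1
  · exact asum a C k ha 0 (by simp)
  · simpa using hr1

noncomputable def c1 (n : ℕ) : ℝ := ((n : ℝ) + 1) * cc (n + 1)
noncomputable def c2 (n : ℕ) : ℝ := ((n : ℝ) + 1) * c1 (n + 1)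
noncomputable def K1 (x : ℝ) : ℝ := ∑' n, c1 n * x ^ n
noncomputable def K2 (x : ℝ) : ℝ := ∑' n, c2 n * x ^ n

lemma b0 (n : ℕ) : |cc n| ≤ 2 * ((n : ℝ) + 1) ^ 0 := by
  simpa [abs_of_pos (cc_pos n)] using cc_le n
lemma b1 (n : ℕ) : |c1 n| ≤ 2 * 2 ^ 0 * ((n : ℝ) + 1) ^ (0 + 1) := dbound cc _ _ b0 n
lemma b2 (n : ℕ) : |c2 n| ≤ 2 * 2 ^ 0 * 2 ^ (0 + 1) * ((n : ℝ) + 1) ^ (0 + 1 + 1) :=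
  dbound c1 _ _ b1 n

lemma K_deriv_s14 (x : ℝ) (hx : |x| < 1) : HasDerivAt K (K1 x) x := by
  refine (dser cc _ _ b0 x hx).congr_of_eventuallyEq ?_
  have : ∀ᶠ y in nhds x, |y| < 1 := (continuous_abs.continuousAt).eventually_lt_const hx
  filter_upwards [this] with y hy
  exact (K_hasSum y hy).tsum_eq.symm

lemma K1_deriv (x : ℝ) (hx : |x| < 1) : HasDerivAt K1 (K2 x) x := dser c1 _ _ b1 x hx

lemma main_sum (p x : ℝ) (hx : |x| < 1) :
    HasSum (fun n : ℕ => cc n / (16 * (n + 1) * (n + 2)) *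
      (16 * p * (p - 1) * (n + 1) * (n + 2) - 8 * p * (n + 2) + 9) * x ^ n)
      (p * (p - 1) * K x - 2 * p * (1 - x) * K1 x + (1 - x) ^ 2 * K2 x) := by
  have h0 := K_hasSum x hx
  have h1 : HasSum (fun n => c1 n * x ^ n) (K1 x) := (asum c1 _ _ b1 x hx).hasSum
  have h2 : HasSum (fun n => c2 n * x ^ n) (K2 x) := (asum c2 _ _ b2 x hx).hasSum
  have h1x := shift cc x _ h1
  have h2x := shift c1 x _ h2
  have h2xx := shift (fun n => ((n : ℝ) - 1) * cc n) x (x * K2 x) (by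
    convert! h2x using 2 with n
    rw [c1]; push_cast; ring)
  have := (((h0.mul_left (p * (p - 1))).sub ((h1.sub h1x).mul_left (2 * p))).add
    ((h2.sub (h2x.mul_left 2)).add h2xx))
  convert! this using 1
  · ext n
    have e1 := cc_succ n
    have e2 := cc_succ (n + 1)
    have e1 : cc (n + 1) = cc n * (n + 1/2) ^ 2 / (n + 1) ^ 2 := by
      rw [eq_div_iff (by positivity)]; exact e1
    have e2 : cc (n + 1 + 1) = cc (n + 1) * (n + 1 + 1/2) ^ 2 / (n + 2) ^ 2 := by
      rw [eq_div_iff (by positivity)]; push_cast at e2; linear_combination e2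
    simp only [c2, c1]
    rw [e2, e1]
    push_cast
    field_simp
    ring
  · ring

lemma h_deriv (p x : ℝ) (hx : x ∈ Ioo (0:ℝ) 1) :
    HasDerivAt (fun x : ℝ => (1 - x) ^ p * K x)
      ((1 - x) ^ (p - 1) * ((1 - x) * K1 x - p * K x)) x := by
  have hx' : |x| < 1 := abs_lt.2 ⟨by linarith [hx.1], hx.2⟩
  have h1 : 0 < 1 - x := by linarith [hx.2]
  have := (((hasDerivAt_id x).const_sub 1).rpow_const (p := p) (Or.inl h1.ne')).mul
    (K_deriv_s14 x hx')
  convert! this using 1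
  have : (1 - x) ^ p = (1 - x) ^ (p - 1) * (1 - x) := by
    rw [← Real.rpow_add_one h1.ne']; ring_nf
  simp only [id, Pi.mul_apply, Pi.sub_apply]
  rw [this]; ring

lemma h_deriv2 (p x : ℝ) (hx : x ∈ Ioo (0:ℝ) 1) :
    HasDerivAt (fun x : ℝ => (1 - x) ^ (p - 1) * ((1 - x) * K1 x - p * K x))
      ((1 - x) ^ (p - 2) *
        (p * (p - 1) * K x - 2 * p * (1 - x) * K1 x + (1 - x) ^ 2 * K2 x)) x := by
  have hx' : |x| < 1 := abs_lt.2 ⟨by linarith [hx.1], hx.2⟩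
  have h1 : 0 < 1 - x := by linarith [hx.2]
  have := (((hasDerivAt_id x).const_sub 1).rpow_const (p := p - 1) (Or.inl h1.ne')).mul
    ((((hasDerivAt_id x).const_sub 1).mul (K1_deriv x hx')).sub ((K_deriv_s14 x hx').const_mul p))
  convert! this using 1
  have : (1 - x) ^ (p - 1) = (1 - x) ^ (p - 2) * (1 - x) := by
    rw [← Real.rpow_add_one h1.ne']; ring_nf
  simp only [id, Pi.mul_apply, Pi.sub_apply]
  rw [this, show p - 1 - 1 = p - 2 by ring]; ring

lemma h_dd (p x : ℝ) (hx : x ∈ Ioo (0:ℝ) 1) :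
    deriv^[2] (fun x : ℝ => (1 - x) ^ p * K x) x = (1 - x) ^ (p - 2) *
        (p * (p - 1) * K x - 2 * p * (1 - x) * K1 x + (1 - x) ^ 2 * K2 x) := by
  simp only [Function.iterate_succ, Function.iterate_zero, Function.comp, id]
  rw [← (h_deriv2 p x hx).deriv]
  apply Filter.EventuallyEq.deriv_eq
  filter_upwards [isOpen_Ioo.mem_nhds hx] with y hy
  exact (h_deriv p y hy).deriv

lemma hsum_pos {f : ℕ → ℝ} {S : ℝ} (h : ∀ n, 0 ≤ f n) (i : ℕ) (hi : 0 < f i)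
    (hf : HasSum f S) : 0 < S := by
  rw [← hf.tsum_eq]
  exact hf.summable.tsum_pos h i hi

lemma h_cont (p : ℝ) : ContinuousOn (fun x : ℝ => (1 - x) ^ p * K x) (Ioo 0 1) :=
  fun x hx => (h_deriv p x hx).continuousAt.continuousWithinAt

theorem stmt14 (p : ℝ) :
    ((p ≤ 0 ∨ p ≥ 3 * (2 + Real.sqrt 2) / 8) →
      StrictConvexOn ℝ (Ioo 0 1) (fun x : ℝ => (1 - x) ^ p * K x)) ∧
    (p ∈ Icc (3 * (2 - Real.sqrt 2) / 8) 1 →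
      StrictConcaveOn ℝ (Ioo 0 1) (fun x : ℝ => (1 - x) ^ p * K x)) := by
  have hs : Real.sqrt 2 ^ 2 = 2 := Real.sq_sqrt (by norm_num)
  have hs1 : 1.4 < Real.sqrt 2 := Real.lt_sqrt_of_sq_lt (by norm_num)
  have hs2 : Real.sqrt 2 < 1.5 := by rw [Real.sqrt_lt' (by norm_num)]; norm_num
  constructor
  · intro hp
    have hn : ∀ n : ℕ, 0 ≤ 16 * p * (p - 1) * (n + 1) * (n + 2) - 8 * p * (n + 2) + 9 := by
      intro n
      have hn : (0:ℝ) ≤ n := Nat.cast_nonneg n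
      rcases hp with hp | hp
      · have e1 : 0 ≤ p * (p - 1) := by nlinarith
        have e2 : 0 ≤ (-p) * ((n:ℝ) + 2) := mul_nonneg (by linarith) (by linarith)
        have e3 : 0 ≤ p * (p - 1) * (((n:ℝ) + 1) * (n + 2)) := by positivity
        nlinarith
      · have h0 : 0 ≤ 32 * p * (p - 1) - 16 * p + 9 := by nlinarith
        have hp1 : 1.2 ≤ p := by linarith
        have : 0 ≤ (n:ℝ) * (8 * p * (2 * (p - 1) * (n + 3) - 1)) := by
          have : 0 ≤ 2 * (p - 1) * ((n:ℝ) + 3) - 1 := by nlinarith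
          have : 0 ≤ p := by linarith
          positivity
        linarith
    have hn1 : (0:ℝ) < 16 * p * (p - 1) * ((1:ℕ) + 1) * ((1:ℕ) + 2) - 8 * p * ((1:ℕ) + 2) + 9 := by
      push_cast
      rcases hp with hp | hp
      · nlinarith
      · have h0 : 0 ≤ 32 * p * (p - 1) - 16 * p + 9 := by nlinarith
        have hp1 : 1.2 ≤ p := by linarith
        nlinarith
    refine strictConvexOn_of_deriv2_pos' (convex_Ioo _ _) (h_cont p) fun x hx => ?_
    rw [h_dd p x hx]
    have hx' : |x| < 1 := abs_lt.2 ⟨by linarith [hx.1], hx.2⟩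
    have hx0 := hx.1
    refine mul_pos (Real.rpow_pos_of_pos (by linarith [hx.2]) _) ?_
    refine hsum_pos (fun n => ?_) 1 ?_ (main_sum p x hx')
    · have := cc_pos n
      have := hn n
      positivity
    · have := cc_pos 1
      exact mul_pos (mul_pos (by positivity) hn1) (by positivity)
  · rintro ⟨hp, hp1⟩
    have h0 : 32 * p * (p - 1) - 16 * p + 9 ≤ 0 := by nlinarith
    have hp0 : 0.1 ≤ p := by linarith
    have hn : ∀ n : ℕ, 0 ≤ -(16 * p * (p - 1) * (n + 1) * (n + 2) - 8 * p * (n + 2) + 9) := by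
      intro n
      have hn : (0:ℝ) ≤ n := Nat.cast_nonneg n
      have : 0 ≤ (n:ℝ) * (8 * p * (2 * (1 - p) * (n + 3) + 1)) := by
        have : 0 ≤ 1 - p := by linarith
        have : 0 ≤ p := by linarith
        positivity
      linarith
    have hn1 : (0:ℝ) < -(16 * p * (p - 1) * ((1:ℕ) + 1) * ((1:ℕ) + 2) - 8 * p * ((1:ℕ) + 2) + 9) := by
      push_cast
      nlinarith
    refine strictConcaveOn_of_deriv2_neg' (convex_Ioo _ _) (h_cont p) fun x hx => ?_
    rw [h_dd p x hx]
    have hx' : |x| < 1 := abs_lt.2 ⟨by linarith [hx.1], hx.2⟩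
    have hx0 := hx.1
    refine mul_neg_of_pos_of_neg (Real.rpow_pos_of_pos (by linarith [hx.2]) _) ?_
    rw [← neg_pos]
    refine hsum_pos (fun n => ?_) 1 ?_ (main_sum p x hx').neg
    · have := cc_pos n
      have := hn n
      rw [← neg_mul, ← mul_neg]
      positivity
    · have := cc_pos 1
      rw [← neg_mul, ← mul_neg]
      exact mul_pos (mul_pos (by positivity) hn1) (by positivity)
end
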